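/- arXiv:1504.07168 — 7 statements merged into one kernel-verified Lean document; each statement's English description precedes it below -/
import Mathlib

section
/- Let 0 < p ≤ 1 be a real number. The function f : (0,∞) → ℝ defined by f(x) = e^x(1−p) + e^x·p²/(4x) − 1 has a root r satisfying 0 < r ≤ p/2. -/
/-- The function f(x) = e^x(1−p) + e^x·p²/(4x) − 1 has a root r with 0 < r ≤ p/2. -/
theorem stmt_0 (p : ℝ) (hp : 0 < p) (hp1 : p ≤ 1) :
    ∃ r : ℝ, 0 < r ∧ r ≤ p / 2 ∧
      Real.exp r * (1 - p) + Real.exp r * p ^ 2 / (4 * r) - 1 = 0 := by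
  have ha : 0 < p ^ 2 / 4 := by positivity
  have hab : p ^ 2 / 4 ≤ p / 2 := by nlinarith
  have hcont : ContinuousOn
      (fun x : ℝ => Real.exp x * (1 - p) + Real.exp x * p ^ 2 / (4 * x) - 1)
      (Set.Icc (p ^ 2 / 4) (p / 2)) := by
    have hne : ∀ x ∈ Set.Icc (p ^ 2 / 4) (p / 2), 4 * x ≠ 0 := fun x hx =>
      mul_ne_zero four_ne_zero (ha.trans_le hx.1).ne'
    fun_prop (disch := assumption)
  have hright : Real.exp (p / 2) * (1 - p) + Real.exp (p / 2) * p ^ 2 / (4 * (p / 2)) - 1 ≤ 0 := by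
    have hmul : Real.exp (p / 2) * (1 - p / 2) ≤ 1 := by
      calc Real.exp (p / 2) * (1 - p / 2)
          ≤ Real.exp (p / 2) * Real.exp (-(p / 2)) := by
            gcongr
            exact Real.one_sub_le_exp_neg _
        _ = 1 := by rw [← Real.exp_add, add_neg_cancel, Real.exp_zero]
    have hdiv : Real.exp (p / 2) * p ^ 2 / (4 * (p / 2)) = Real.exp (p / 2) * (p / 2) := by
      field_simp
      norm_num
    linarith
  have hleft : 0 ≤ Real.exp (p ^ 2 / 4) * (1 - p)
      + Real.exp (p ^ 2 / 4) * p ^ 2 / (4 * (p ^ 2 / 4)) - 1 := by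
    have hdiv : Real.exp (p ^ 2 / 4) * p ^ 2 / (4 * (p ^ 2 / 4)) = Real.exp (p ^ 2 / 4) := by
      field_simp
    have hnonneg : 0 ≤ Real.exp (p ^ 2 / 4) * (1 - p) :=
      mul_nonneg (Real.exp_pos _).le (sub_nonneg.2 hp1)
    linarith [Real.one_le_exp ha.le]
  obtain ⟨r, hr, hfr⟩ := intermediate_value_Icc' hab hcont ⟨hright, hleft⟩
  exact ⟨r, ha.trans_le hr.1, hr.2, hfr⟩
end

section
/- Let m ≥ 1 be an integer and 0 < p < 1 a real number. Then there exists a real b > 1 such that (1−p)·b^m < 1 and 1 + 2·b^m / ( (b−1)·(1 − (1−p)·b^m) ) ≤ 1 + 8m/p². -/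
/-- There is a base b > 1 with (1−p)·b^m < 1 such that the competitive-ratio bound
    1 + 2·b^m/((b−1)·(1 − (1−p)·b^m)) is at most 1 + 8m/p². -/
theorem stmt_3 (m : ℕ) (hm : 1 ≤ m) (p : ℝ) (hp : 0 < p) (hp1 : p < 1) :
    ∃ b : ℝ, 1 < b ∧ (1 - p) * b ^ m < 1 ∧
      1 + 2 * b ^ m / ((b - 1) * (1 - (1 - p) * b ^ m)) ≤ 1 + 8 * m / p ^ 2 := by
  have hm1 : (1 : ℝ) ≤ m := by exact_mod_cast hm
  have hm0 : (0 : ℝ) < m := by linarith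
  obtain ⟨t, ht⟩ : ∃ t : ℝ, t = p / (2 * m) := ⟨_, rfl⟩
  have ht0 : 0 < t := by rw [ht]; positivity
  have hmt : m * t = p / 2 := by rw [ht]; field_simp
  have ht1 : t < 1 := by nlinarith
  have hc : 0 < 1 - t := by linarith
  have bernoulli : 1 - p / 2 ≤ (1 - t) ^ m := by
    have := one_add_mul_le_pow (a := -t) (by linarith) m
    rw [← sub_eq_add_neg] at this
    linarith
  have hy : 0 < (1 - t) ^ m := pow_pos hc m
  have hbase : t ≤ (1 - t)⁻¹ - 1 := by
    rw [le_sub_iff_add_le, ← one_div, le_div_iff₀ hc]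
    nlinarith
  refine ⟨(1 - t)⁻¹, by linarith, ?_, ?_⟩
  · rw [inv_pow, ← div_eq_mul_inv, div_lt_one hy]
    linarith
  · have hgap : p / 2 ≤ (1 - t) ^ m - (1 - p) := by linarith
    have key : 2 * (1 - t)⁻¹ ^ m / (((1 - t)⁻¹ - 1) * (1 - (1 - p) * (1 - t)⁻¹ ^ m))
        = 2 / (((1 - t)⁻¹ - 1) * ((1 - t) ^ m - (1 - p))) := by
      rw [inv_pow, show 1 - (1 - p) * ((1 - t) ^ m)⁻¹
        = ((1 - t) ^ m - (1 - p)) * ((1 - t) ^ m)⁻¹ by field_simp, ← mul_assoc,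
        mul_div_mul_right _ _ (inv_ne_zero hy.ne')]
    rw [key]
    calc 1 + 2 / (((1 - t)⁻¹ - 1) * ((1 - t) ^ m - (1 - p)))
        ≤ 1 + 2 / (t * (p / 2)) := by gcongr; linarith
      _ = 1 + 8 * m / p ^ 2 := by rw [ht]; field_simp; ring
end

section
/- Let m ≥ 1 and l ≥ 0 be integers, let b > 1 and 0 < p < 1 be reals with (1−p)·b^m < 1, and let d be a real number with d > b^l. Then the series ∑_{k=1}^{∞} p(1−p)^{k−1} · ( 2·∑_{j=0}^{l+mk−1} b^j + d ) converges and its sum is at most d · ( 1 + 2·b^m / ( (b−1)·(1 − (1−p)·b^m) ) ). -/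
/-- The expected-cost series ∑_{k=1}^∞ p(1−p)^{k−1}·(2·∑_{j=0}^{l+mk−1} b^j + d)
    converges, with sum at most d·(1 + 2·b^m/((b−1)·(1 − (1−p)·b^m))).
    Here the summation index k ≥ 1 is represented as k = K + 1 with K : ℕ. -/
theorem stmt_4 (m l : ℕ) (hm : 1 ≤ m) (b : ℝ) (hb : 1 < b) (p : ℝ) (hp : 0 < p)
    (hp1 : p < 1) (hlam : (1 - p) * b ^ m < 1) (d : ℝ) (hd : b ^ l < d) :
    Summable (fun K : ℕ =>
      p * (1 - p) ^ K * (2 * ∑ j ∈ Finset.range (l + m * (K + 1)), b ^ j + d)) ∧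
    ∑' K : ℕ,
        p * (1 - p) ^ K * (2 * ∑ j ∈ Finset.range (l + m * (K + 1)), b ^ j + d)
      ≤ d * (1 + 2 * b ^ m / ((b - 1) * (1 - (1 - p) * b ^ m))) := by
  have hb1 : 0 < b - 1 := sub_pos.mpr hb
  have hq : 0 ≤ 1 - p := by linarith
  have hden : 0 < 1 - (1 - p) * b ^ m := sub_pos.mpr hlam
  have key : HasSum (fun K : ℕ =>
      p * (1 - p) ^ K * (2 * ∑ j ∈ Finset.range (l + m * (K + 1)), b ^ j + d))
      (2 * p * b ^ l * b ^ m / (b - 1) * (1 - (1 - p) * b ^ m)⁻¹ +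
        p * (d - 2 / (b - 1)) * (1 - (1 - p))⁻¹) := by
    have hgeom := hasSum_geometric_of_lt_one (r := (1 - p) * b ^ m) (by positivity) hlam
    have hgeom' := hasSum_geometric_of_lt_one (r := 1 - p) hq (by linarith)
    have hsum := (hgeom.mul_left (2 * p * b ^ l * b ^ m / (b - 1))).add
      (hgeom'.mul_left (p * (d - 2 / (b - 1))))
    refine (congrArg (HasSum · _) (funext fun K ↦ ?_)).mpr hsum
    rw [geom_sum_eq hb.ne', pow_add, pow_mul, pow_succ, mul_pow]
    field_simp
    ring
  refine ⟨key.summable, ?_⟩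
  rw [key.tsum_eq]
  have hpd : p * b ^ l ≤ d :=
    (mul_le_of_le_one_left (by positivity) hp1.le).trans hd.le
  have hconst : p * (d - 2 / (b - 1)) * (1 - (1 - p))⁻¹ = d - 2 / (b - 1) := by
    rw [sub_sub_cancel]
    field_simp
  calc
    _ = p * b ^ l * (2 * b ^ m / ((b - 1) * (1 - (1 - p) * b ^ m))) + (d - 2 / (b - 1)) := by
      rw [hconst]
      field_simp
    _ ≤ d * (2 * b ^ m / ((b - 1) * (1 - (1 - p) * b ^ m))) + d := by
      gcongr
      exact sub_le_self _ (by positivity)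
    _ = _ := by ring
end

section
/- Let N ≥ 2 and l ≥ 0 be integers, set b = N/(N−1), and let d be a real number with d > b^l. Then ( 2·∑_{i=0}^{l+N−1} b^i + d ) / d ≤ 1 + 2·(N−1)·(N/(N−1))^N ≤ 1 + 2·e·N, where e is Euler's number. -/
/-- With b = N/(N−1) and d > b^l,
    (2·∑_{i=0}^{l+N−1} b^i + d)/d ≤ 1 + 2·(N−1)·(N/(N−1))^N ≤ 1 + 2·e·N. -/
theorem stmt_8 (N l : ℕ) (hN : 2 ≤ N) (d : ℝ)
    (hd : ((N : ℝ) / ((N : ℝ) - 1)) ^ l < d) :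
    (2 * ∑ i ∈ Finset.range (l + N), ((N : ℝ) / ((N : ℝ) - 1)) ^ i + d) / d ≤
        1 + 2 * ((N : ℝ) - 1) * ((N : ℝ) / ((N : ℝ) - 1)) ^ N ∧
    1 + 2 * ((N : ℝ) - 1) * ((N : ℝ) / ((N : ℝ) - 1)) ^ N ≤
        1 + 2 * Real.exp 1 * N := by
  have hN1 : (0 : ℝ) < (N : ℝ) - 1 := by
    have : (2 : ℝ) ≤ N := by exact_mod_cast hN
    linarith
  set b : ℝ := (N : ℝ) / ((N : ℝ) - 1) with hb
  have hb_mul : ((N : ℝ) - 1) * b = N := mul_div_cancel₀ _ hN1.ne'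
  have hb_pos : 0 < b := div_pos (by linarith) hN1
  have hd_pos : 0 < d := (pow_pos hb_pos l).trans hd
  refine ⟨?_, ?_⟩
  · have hsum : ∑ i ∈ Finset.range (l + N), b ^ i = ((N : ℝ) - 1) * (b ^ (l + N) - 1) := by
      rw [← geom_sum_mul]
      linear_combination (-∑ i ∈ Finset.range (l + N), b ^ i) * hb_mul
    have hbound : ((N : ℝ) - 1) * (b ^ l * b ^ N) ≤ ((N : ℝ) - 1) * (d * b ^ N) := by
      gcongr
    rw [div_le_iff₀ hd_pos, hsum, pow_add]
    linarith
  · have hexp : b ^ (N - 1) ≤ Real.exp 1 := by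
      have hcast : ((N - 1 : ℕ) : ℝ) = (N : ℝ) - 1 := by
        rw [Nat.cast_sub (by omega), Nat.cast_one]
      have hle : b ≤ Real.exp (1 / ((N : ℝ) - 1)) := by
        have hb_eq : b = 1 / ((N : ℝ) - 1) + 1 := by
          rw [hb]
          field_simp
          ring
        rw [hb_eq]
        exact Real.add_one_le_exp _
      calc b ^ (N - 1) ≤ Real.exp (1 / ((N : ℝ) - 1)) ^ (N - 1) := by gcongr
        _ = Real.exp 1 := by
          rw [← Real.exp_nat_mul, hcast, mul_one_div_cancel hN1.ne']
    have hpow : b ^ N = b * b ^ (N - 1) := by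
      rw [← pow_succ', Nat.sub_add_cancel (by omega)]
    have hmul : ((N : ℝ) - 1) * b ^ N = N * b ^ (N - 1) := by
      rw [hpow, ← mul_assoc, hb_mul]
    have hbound : (N : ℝ) * b ^ (N - 1) ≤ N * Real.exp 1 := by gcongr
    linarith
end

section
/- Let m ≥ 1 and l ≥ 0 be integers, let b > 1 be real, and let r ≥ 2 be a real number. Then r·∑_{j=0}^{l+m} b^j + (2−r)·∑_{j=0}^{l} b^j ≤ b^l · ( r·b^{m+1}/(b−1) + 2 − r ). -/
theorem geom_sum_le_pow_div {b : ℝ} (hb : 1 < b) (n : ℕ) :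
    ∑ j ∈ Finset.range n, b ^ j ≤ b ^ n / (b - 1) := by
  have hb' : 0 < b - 1 := sub_pos.mpr hb
  rw [geom_sum_eq hb.ne']
  gcongr
  linarith

theorem pow_le_geom_sum {b : ℝ} (hb : 0 ≤ b) (n : ℕ) :
    b ^ n ≤ ∑ j ∈ Finset.range (n + 1), b ^ j :=
  Finset.single_le_sum (f := fun j => b ^ j) (fun _ _ => pow_nonneg hb _)
    (Finset.self_mem_range_succ n)

/-- r·∑_{j=0}^{l+m} b^j + (2−r)·∑_{j=0}^{l} b^j ≤ b^l·(r·b^{m+1}/(b−1) + 2 − r). -/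
theorem stmt_9 (m l : ℕ) (hm : 1 ≤ m) (b : ℝ) (hb : 1 < b) (r : ℝ) (hr : 2 ≤ r) :
    r * ∑ j ∈ Finset.range (l + m + 1), b ^ j +
      (2 - r) * ∑ j ∈ Finset.range (l + 1), b ^ j ≤
    b ^ l * (r * b ^ (m + 1) / (b - 1) + 2 - r) := by
  calc
    _ ≤ r * (b ^ (l + m + 1) / (b - 1)) + (2 - r) * b ^ l :=
      add_le_add
        (mul_le_mul_of_nonneg_left (geom_sum_le_pow_div hb _) (by linarith))
        (mul_le_mul_of_nonpos_left (pow_le_geom_sum (by linarith) l) (by linarith))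
    _ = _ := by ring
end

section
/- Let n ≥ 1 and k ≥ 1 be integers, let b > 1 be real, and let 0 ≤ δ < 1. Then both ( (b^{k+1} − 1)/(b−1) ) / ( b^k·(b^n − 1)/(n·b^n·ln b) ) ≤ n·b^{n+1}·ln b / ( (b^n − 1)(b−1) ) and ( ((b^k − 1)/(b−1))·b^δ ) / ( b^{k−1}·(b^n − 1)·b^δ/(n·b^n·ln b) ) ≤ n·b^{n+1}·ln b / ( (b^n − 1)(b−1) ). -/
/-- If `x - 1 ≤ b * y`, dividing `(x - 1) / (b - 1)` by `y * N / M` gives at most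
`M * b / (N * (b - 1))`. -/
lemma div_div_le_of_sub_one_le {b x y N M : ℝ} (hb : 1 < b) (hy : 0 < y) (hN : 0 < N)
    (hM : 0 < M) (h : x - 1 ≤ b * y) :
    ((x - 1) / (b - 1)) / (y * N / M) ≤ M * b / (N * (b - 1)) := by
  have hb' : 0 < b - 1 := sub_pos.2 hb
  calc ((x - 1) / (b - 1)) / (y * N / M)
      ≤ ((b * y) / (b - 1)) / (y * N / M) := by gcongr
    _ = M * b / (N * (b - 1)) := by field_simp

/-- In both cases of the randomized-schedule analysis, t/E[D] is at most
    n·b^{n+1}·ln b/((b^n − 1)(b − 1)). -/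
theorem stmt_13 (n k : ℕ) (hn : 1 ≤ n) (hk : 1 ≤ k) (b : ℝ) (hb : 1 < b)
    (δ : ℝ) (hδ0 : 0 ≤ δ) (hδ1 : δ < 1) :
    ((b ^ (k + 1) - 1) / (b - 1)) / (b ^ k * (b ^ n - 1) / ((n : ℝ) * b ^ n * Real.log b))
      ≤ (n : ℝ) * b ^ (n + 1) * Real.log b / ((b ^ n - 1) * (b - 1)) ∧
    (((b ^ k - 1) / (b - 1)) * b ^ δ) /
        (b ^ ((k : ℝ) - 1) * (b ^ n - 1) * b ^ δ / ((n : ℝ) * b ^ n * Real.log b))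
      ≤ (n : ℝ) * b ^ (n + 1) * Real.log b / ((b ^ n - 1) * (b - 1)) := by
  have hb0 : 0 < b := by linarith
  have hN : 0 < b ^ n - 1 := sub_pos.2 (one_lt_pow₀ hb (by omega))
  have hM : 0 < (n : ℝ) * b ^ n * Real.log b := by
    have := Real.log_pos hb
    have : (0 : ℝ) < n := by exact_mod_cast hn
    positivity
  have hR : (n : ℝ) * b ^ (n + 1) * Real.log b = (n : ℝ) * b ^ n * Real.log b * b := by ring
  have hδ : 0 < b ^ δ := Real.rpow_pos_of_pos hb0 δ
  have hy : 0 < b ^ ((k : ℝ) - 1) := Real.rpow_pos_of_pos hb0 _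
  rw [hR]
  refine ⟨div_div_le_of_sub_one_le hb (by positivity) hN hM ?_, ?_⟩
  · rw [pow_succ']
    linarith
  · rw [mul_div_right_comm (b ^ ((k : ℝ) - 1) * (b ^ n - 1)), mul_div_mul_right _ _ hδ.ne']
    refine div_div_le_of_sub_one_le hb hy hN hM ?_
    rw [Real.rpow_sub_one hb0.ne', Real.rpow_natCast, mul_div_cancel₀ _ hb0.ne']
    linarith
end

section
/- The sequence c_n = n²·((n+1)/n)^{n+1}·ln((n+1)/n) / ( ( ((n+1)/n)^n − 1 )·(n+1) ) converges to e/(e−1) as n → ∞, where e is Euler's number. -/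
/-- The compound interest sequence `((n + 1) / n) ^ n` converges to `e`. -/
theorem tendsto_add_one_div_self_pow_exp_one :
    Filter.Tendsto (fun n : ℕ => (((n : ℝ) + 1) / n) ^ n) Filter.atTop (nhds (Real.exp 1)) := by
  refine (Real.tendsto_one_add_div_pow_exp 1).congr' ?_
  filter_upwards [Filter.eventually_ne_atTop 0] with n hn
  rw [add_div, div_self (Nat.cast_ne_zero.mpr hn)]

/-- c_n = n²·((n+1)/n)^{n+1}·ln((n+1)/n) / ((((n+1)/n)^n − 1)·(n+1)) → e/(e−1). -/
theorem stmt_14 :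
    Filter.Tendsto
      (fun n : ℕ =>
        (n : ℝ) ^ 2 * (((n : ℝ) + 1) / n) ^ (n + 1) * Real.log (((n : ℝ) + 1) / n) /
          (((((n : ℝ) + 1) / n) ^ n - 1) * ((n : ℝ) + 1)))
      Filter.atTop (nhds (Real.exp 1 / (Real.exp 1 - 1))) := by
  have h := tendsto_add_one_div_self_pow_exp_one
  have hne : Real.exp 1 - 1 ≠ 0 := (sub_pos.mpr (Real.one_lt_exp_iff.mpr one_pos)).ne'
  have hlim := (h.mul (h.log (Real.exp_ne_zero 1))).div (h.sub_const 1) hne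
  rw [Real.log_exp, mul_one] at hlim
  refine hlim.congr' ?_
  filter_upwards [Filter.eventually_ne_atTop 0] with n hn
  have hn' : (n : ℝ) ≠ 0 := Nat.cast_ne_zero.mpr hn
  have hn1 : (n : ℝ) + 1 ≠ 0 := n.cast_add_one_ne_zero
  simp only [Pi.div_apply]
  rw [← mul_div_mul_right _ _ hn1, Real.log_pow, pow_succ (((n : ℝ) + 1) / n) n]
  congr 1
  generalize (((n : ℝ) + 1) / n) ^ n = A
  generalize Real.log (((n : ℝ) + 1) / n) = L
  field_simp
end
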